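/- Weak Epsilon Net Theorem (Alon–Bárány–Füredi–Kleitman): For every dimension d ≥ 1 there exists a function f : (0,1] → ℝ with the following property. For any ε ∈ (0,1], if 𝒞 is a finite family of convex bodies in ℝ^d and w : ℝ^d → [0,1] is a weight function with finite support such that ∑_{x ∈ ℝ^d} w(x) = 1 and ∑_{x ∈ C} w(x) ≥ ε for every C ∈ 𝒞, then there is a finite set S ⊆ ℝ^d with |S| ≤ f(ε) such that each C ∈ 𝒞 contains an element of S. -/

import Mathlib

open Finset in
lemma sum_biUnion_le_of_nonneg {α β : Type*} [DecidableEq β] {s : Finset α} {t : α → Finset β}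
    {f : β → ℝ} (hf : ∀ b, 0 ≤ f b) : ∑ b ∈ s.biUnion t, f b ≤ ∑ a ∈ s, ∑ b ∈ t a, f b := by
  classical
  induction s using Finset.induction_on with
  | empty => simp
  | insert a s ha ih =>
    rw [biUnion_insert, sum_insert ha]
    have h1 := sum_union_inter (s₁ := t a) (s₂ := s.biUnion t) (f := f)
    have h2 : 0 ≤ ∑ b ∈ t a ∩ s.biUnion t, f b := sum_nonneg fun b _ => hf b
    linarith

open Finset in
/-- A sample `v` of independent points whose entries all fall into a set `H (v ∘ e)` determined by
few of the entries is unlikely, if all the sets `H a` have weight at most `r` times the total. -/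
lemma sum_prod_filter_forall_mem_le {ι κ τ : Type*} [Fintype ι] [Fintype κ] [DecidableEq κ]
    [Fintype τ] [DecidableEq ι] (u : ι → ℝ) (hu : ∀ i, 0 ≤ u i) (r : ℝ) (hr0 : 0 ≤ r) (hr1 : r ≤ 1)
    (e : τ → κ) (H : (τ → ι) → Finset ι) (hH : ∀ a, ∑ i ∈ H a, u i ≤ r * ∑ i, u i) :
    ∑ v : κ → ι with ∀ j, v j ∈ H (v ∘ e), ∏ j, u (v j) ≤
      r ^ (Fintype.card κ - Fintype.card τ) * (∑ i, u i) ^ Fintype.card κ := by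
  classical
  set m := ∑ i, u i with hm
  have hm0 : 0 ≤ m := sum_nonneg fun i _ => hu i
  let p : κ → Prop := fun j => j ∈ Set.range e
  let g : ({j // p j} → ι) → Finset ι := fun a => H fun t => a ⟨e t, t, rfl⟩
  have hcard : Fintype.card {j // p j} + Fintype.card {j // ¬ p j} = Fintype.card κ := by
    rw [Fintype.card_subtype_compl]
    have := Fintype.card_subtype_le p
    omega
  have hcard' : Fintype.card {j // p j} ≤ Fintype.card τ := Fintype.card_range_le e
  calc ∑ v : κ → ι with ∀ j, v j ∈ H (v ∘ e), ∏ j, u (v j)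
      ≤ ∑ v : κ → ι, (∏ j : {j // p j}, u (v j)) *
          if ∀ j : {j // ¬ p j}, v j ∈ H (v ∘ e) then ∏ j : {j // ¬ p j}, u (v j) else 0 := by
        rw [sum_filter]
        refine sum_le_sum fun v _ => ?_
        by_cases h : ∀ j, v j ∈ H (v ∘ e)
        · have h' : ∀ j : {j // ¬ p j}, v j ∈ H (v ∘ e) := fun j => h j
          rw [if_pos h', if_pos h]
          convert (Fintype.prod_subtype_mul_prod_subtype p fun j => u (v j)).ge
        · rw [if_neg h]
          refine mul_nonneg (prod_nonneg fun j _ => hu _) ?_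
          split_ifs
          exacts [prod_nonneg fun j _ => hu _, le_rfl]
    _ = ∑ ab : ({j // p j} → ι) × ({j // ¬ p j} → ι), (∏ j, u (ab.1 j)) *
          if ∀ j, ab.2 j ∈ g ab.1 then ∏ j, u (ab.2 j) else 0 :=
        Fintype.sum_equiv (Equiv.piEquivPiSubtypeProd p fun _ => ι) _ _ fun v => rfl
    _ = ∑ a : {j // p j} → ι, (∏ j, u (a j)) * (∑ i ∈ g a, u i) ^ Fintype.card {j // ¬ p j} := by
        rw [Fintype.sum_prod_type]
        refine sum_congr rfl fun a _ => ?_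
        dsimp only
        rw [← mul_sum, ← sum_filter]
        congr 1
        rw [← Finset.card_univ, ← prod_const, prod_univ_sum]
        refine sum_congr ?_ fun _ _ => rfl
        ext b
        simp
    _ ≤ ∑ a : {j // p j} → ι, (∏ j, u (a j)) * (r * m) ^ Fintype.card {j // ¬ p j} := by
        refine sum_le_sum fun a _ => ?_
        refine mul_le_mul_of_nonneg_left ?_ (prod_nonneg fun j _ => hu _)
        exact pow_le_pow_left₀ (sum_nonneg fun i _ => hu i) (hH _) _
    _ = r ^ Fintype.card {j // ¬ p j} * m ^ Fintype.card κ := by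
        have : ∑ a : {j // p j} → ι, ∏ j, u (a j) = m ^ Fintype.card {j // p j} := by
          rw [hm, ← Finset.card_univ, ← prod_const, prod_univ_sum, Fintype.piFinset_univ]
        rw [← sum_mul, this, mul_pow, ← hcard, pow_add]
        ring
    _ ≤ r ^ (Fintype.card κ - Fintype.card τ) * m ^ Fintype.card κ := by
        refine mul_le_mul_of_nonneg_right ?_ (pow_nonneg hm0 _)
        exact pow_le_pow_of_le_one hr0 hr1 (by omega)

section

variable {E : Type*} [NormedAddCommGroup E] [InnerProductSpace ℝ E]

/-- A point of a convex set that minimizes the distance to `p` supports the set. -/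
lemma inner_sub_pos_of_forall_norm_le {K : Set E} (hK : Convex ℝ K) {p q : E} (hp : p ∉ K)
    (hq : q ∈ K) (hmin : ∀ y ∈ K, ‖p - q‖ ≤ ‖p - y‖) {y : E} (hy : y ∈ K) :
    0 < inner ℝ (q - p) (y - p) := by
  have : Nonempty K := ⟨⟨q, hq⟩⟩
  have hinf : ‖p - q‖ = ⨅ w : K, ‖p - w‖ :=
    le_antisymm (le_ciInf fun w => hmin w w.2)
      (ciInf_le ⟨0, Set.forall_mem_range.2 fun w : K => norm_nonneg (p - w)⟩ (⟨q, hq⟩ : K))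
  have h := (norm_eq_iInf_iff_real_inner_le_zero hK hq).1 hinf y hy
  have hqp : 0 < inner ℝ (q - p) (q - p) :=
    real_inner_self_pos.2 (sub_ne_zero.2 fun h => hp (h ▸ hq))
  have e1 : y - p = (y - q) + (q - p) := by abel
  have e2 : p - q = -(q - p) := by abel
  rw [e2, inner_neg_left] at h
  rw [e1, inner_add_right]
  linarith

/-- The convex hull of a finite family has a point nearest to `p`. -/
lemma exists_norm_sub_le_of_mem_convexHull_range {κ : Type*} [Finite κ] [Nonempty κ] (x : κ → E)
    (p : E) : ∃ q ∈ convexHull ℝ (Set.range x),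
      ∀ y ∈ convexHull ℝ (Set.range x), ‖p - q‖ ≤ ‖p - y‖ := by
  have hcont : ContinuousOn (fun y => ‖p - y‖) (convexHull ℝ (Set.range x)) := by fun_prop
  exact ((Set.finite_range x).isCompact_convexHull ℝ).exists_isMinOn
    (Set.range_nonempty x).convexHull hcont

variable [FiniteDimensional ℝ E]

open Module

/-- Carathéodory's theorem for indexed families. -/
lemma exists_fin_mem_convexHull_range_comp {κ : Type*} (x : κ → E) {q : E}
    (hq : q ∈ convexHull ℝ (Set.range x)) :
    ∃ e : Fin (finrank ℝ E + 1) → κ, q ∈ convexHull ℝ (Set.range (x ∘ e)) := by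
  classical
  rw [convexHull_eq_union] at hq
  simp only [Set.mem_iUnion] at hq
  obtain ⟨t, ht, hind, hqt⟩ := hq
  have hne : t.Nonempty := by
    rw [Finset.nonempty_iff_ne_empty]
    rintro rfl
    simp at hqt
  have : Nonempty t := hne.to_subtype
  have hcard : Fintype.card t ≤ finrank ℝ E + 1 :=
    hind.card_le_finrank_succ.trans (Nat.succ_le_succ (Submodule.finrank_le _))
  obtain ⟨emb⟩ : Nonempty (t ↪ Fin (finrank ℝ E + 1)) :=
    Function.Embedding.nonempty_of_card_le (by simpa using hcard)
  choose c hc using fun y : t => ht y.2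
  refine ⟨fun i => c (Function.invFun emb i), convexHull_mono ?_ hqt⟩
  intro y hy
  exact ⟨emb ⟨y, hy⟩, by simp [Function.leftInverse_invFun emb.injective _, hc]⟩

open Finset in
/-- The centerpoint theorem for weighted points. -/
lemma exists_centerpoint {ι : Type*} [Fintype ι] (x : ι → E) (u : ι → ℝ) (hu : ∀ i, 0 ≤ u i) :
    ∃ p : E, ∀ Y : Finset ι, finrank ℝ E * ∑ i, u i < (finrank ℝ E + 1) * ∑ i ∈ Y, u i →
      p ∈ convexHull ℝ (x '' Y) := by
  classical
  set m := ∑ i, u i with hm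
  have hm0 : 0 ≤ m := sum_nonneg fun i _ => hu i
  let F : Finset (Finset ι) := {Y | finrank ℝ E * m < (finrank ℝ E + 1) * ∑ i ∈ Y, u i}
  have hF : (⋂ Y ∈ F, convexHull ℝ (x '' (Y : Set ι))).Nonempty := by
    refine Convex.helly_theorem' (𝕜 := ℝ) (fun Y _ => convex_convexHull ℝ _) fun G hG hGc => ?_
    rcases G.eq_empty_or_nonempty with rfl | hne
    · simp
    by_cases hi : ∃ i, ∀ Y ∈ G, i ∈ Y
    · obtain ⟨i, hi⟩ := hi
      refine ⟨x i, Set.mem_iInter₂.2 fun Y hY => subset_convexHull ℝ _ ⟨i, hi Y hY, rfl⟩⟩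
    push Not at hi
    exfalso
    have h1 : m ≤ ∑ Y ∈ G, ∑ i ∈ Yᶜ, u i := by
      rw [hm]
      calc ∑ i, u i ≤ ∑ i ∈ G.biUnion fun Y => Yᶜ, u i := by
            refine sum_le_sum_of_subset_of_nonneg (fun i _ => ?_) fun i _ _ => hu i
            simpa using hi i
        _ ≤ _ := sum_biUnion_le_of_nonneg hu
    have h2 : ∑ Y ∈ G, (finrank ℝ E + 1) * ∑ i ∈ Yᶜ, u i < ∑ Y ∈ G, m := by
      refine sum_lt_sum_of_nonempty hne fun Y hY => ?_
      have h3 := (mem_filter.1 (hG hY)).2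
      have h4 := sum_add_sum_compl Y u
      rw [← hm] at h4
      rw [← h4] at h3 ⊢
      linarith
    rw [← mul_sum, sum_const, nsmul_eq_mul] at h2
    have h5 : (#G : ℝ) ≤ finrank ℝ E + 1 := by exact_mod_cast hGc
    have h6 := mul_le_mul_of_nonneg_right h5 hm0
    have h7 : (finrank ℝ E + 1 : ℝ) * m ≤ (finrank ℝ E + 1) * ∑ Y ∈ G, ∑ i ∈ Yᶜ, u i :=
      mul_le_mul_of_nonneg_left h1 (by positivity)
    linarith
  obtain ⟨p, hp⟩ := hF
  refine ⟨p, fun Y hY => ?_⟩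
  exact Set.mem_iInter₂.1 hp Y (by simpa [F] using hY)

open Finset in
open Classical in
/-- A selection lemma: for large `k`, some point lies in the convex hulls of at least half (by
weight) of all `k`-tuples. -/
lemma exists_point_in_half_of_hulls (k : ℕ)
    (hk0 : 0 < k) (hk : 2 * ((k : ℝ) ^ (finrank ℝ E + 1) *
      (finrank ℝ E / (finrank ℝ E + 1) : ℝ) ^ (k - (finrank ℝ E + 1))) ≤ 1)
    {ι : Type*} [Fintype ι] (x : ι → E) (u : ι → ℝ) (hu : ∀ i, 0 ≤ u i) :
    ∃ p : E, (∑ i, u i) ^ k ≤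
      2 * ∑ v : Fin k → ι with p ∈ convexHull ℝ (Set.range (x ∘ v)), ∏ j, u (v j) := by
  obtain ⟨p, hp⟩ := exists_centerpoint x u hu
  refine ⟨p, ?_⟩
  set D := finrank ℝ E
  set m := ∑ i, u i with hm
  have hm0 : 0 ≤ m := sum_nonneg fun i _ => hu i
  set r : ℝ := D / (D + 1) with hr
  have hr0 : 0 ≤ r := by positivity
  have hr1 : r ≤ 1 := by rw [hr, div_le_one (by positivity)]; linarith
  have hq : ∀ a : Fin (D + 1) → ι, ∃ q ∈ convexHull ℝ (Set.range (x ∘ a)),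
      ∀ y ∈ convexHull ℝ (Set.range (x ∘ a)), ‖p - q‖ ≤ ‖p - y‖ :=
    fun a => exists_norm_sub_le_of_mem_convexHull_range (x ∘ a) p
  choose q hq hqmin using hq
  let H : (Fin (D + 1) → ι) → Finset ι := fun a => {i | 0 < inner ℝ (q a - p) (x i - p)}
  have hH : ∀ a, ∑ i ∈ H a, u i ≤ r * m := by
    intro a
    by_contra! hlt
    have hpa : p ∈ convexHull ℝ (x '' (H a : Set ι)) := by
      refine hp _ ?_
      rw [hr, div_mul_eq_mul_div, div_lt_iff₀ (by positivity)] at hlt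
      linarith
    have hconv : Convex ℝ {y : E | inner ℝ (q a - p) p < inner ℝ (q a - p) y} :=
      convex_halfSpace_gt (innerₛₗ ℝ (q a - p)).isLinear _
    have hsub : convexHull ℝ (x '' (H a : Set ι)) ⊆
        {y : E | inner ℝ (q a - p) p < inner ℝ (q a - p) y} := by
      refine convexHull_min ?_ hconv
      rintro _ ⟨i, hi, rfl⟩
      simpa [H, inner_sub_right] using hi
    have := hsub hpa
    simp at this
  have hcover : ∀ v : Fin k → ι, p ∉ convexHull ℝ (Set.range (x ∘ v)) →
      ∃ e : Fin (D + 1) → Fin k, ∀ j, v j ∈ H (v ∘ e) := by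
    intro v hv
    have : Nonempty (Fin k) := ⟨⟨0, hk0⟩⟩
    obtain ⟨z, hz, hzmin⟩ : ∃ z ∈ convexHull ℝ (Set.range (x ∘ v)),
        ∀ y ∈ convexHull ℝ (Set.range (x ∘ v)), ‖p - z‖ ≤ ‖p - y‖ :=
      exists_norm_sub_le_of_mem_convexHull_range (x ∘ v) p
    obtain ⟨e, he⟩ := exists_fin_mem_convexHull_range_comp (x ∘ v) hz
    have hmono : convexHull ℝ (Set.range (x ∘ (v ∘ e))) ⊆ convexHull ℝ (Set.range (x ∘ v)) :=
      convexHull_mono (Set.range_comp_subset_range e (x ∘ v))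
    refine ⟨e, fun j => ?_⟩
    simp only [H, mem_filter, mem_univ, true_and]
    exact inner_sub_pos_of_forall_norm_le (convex_convexHull ℝ _) hv (hmono (hq _))
      (fun y hy => (hqmin (v ∘ e) z he).trans (hzmin y hy))
      (subset_convexHull ℝ _ ⟨j, rfl⟩)
  have hprod : ∀ v : Fin k → ι, 0 ≤ ∏ j, u (v j) := fun v => prod_nonneg fun j _ => hu _
  have htotal : ∑ v : Fin k → ι, ∏ j, u (v j) = m ^ k := by
    have := prod_univ_sum (fun _ : Fin k => (univ : Finset ι)) fun _ i => u i
    rw [prod_const, Finset.card_univ, Fintype.card_fin, Fintype.piFinset_univ] at this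
    exact this.symm
  have hbad : ∑ v : Fin k → ι with p ∉ convexHull ℝ (Set.range (x ∘ v)), ∏ j, u (v j) ≤
      (k : ℝ) ^ (D + 1) * r ^ (k - (D + 1)) * m ^ k := by
    calc ∑ v : Fin k → ι with p ∉ convexHull ℝ (Set.range (x ∘ v)), ∏ j, u (v j)
        ≤ ∑ v ∈ univ.biUnion fun e : Fin (D + 1) → Fin k =>
            ({v | ∀ j, v j ∈ H (v ∘ e)} : Finset (Fin k → ι)), ∏ j, u (v j) := by
          refine sum_le_sum_of_subset_of_nonneg (fun v hv => ?_) fun v _ _ => hprod v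
          simpa using hcover v (by simpa using hv)
      _ ≤ ∑ e : Fin (D + 1) → Fin k, ∑ v : Fin k → ι with ∀ j, v j ∈ H (v ∘ e), ∏ j, u (v j) :=
          sum_biUnion_le_of_nonneg hprod
      _ ≤ ∑ e : Fin (D + 1) → Fin k, r ^ (k - (D + 1)) * m ^ k := by
          refine sum_le_sum fun e _ => ?_
          have h := sum_prod_filter_forall_mem_le u hu r hr0 hr1 e H hH
          rw [Fintype.card_fin, Fintype.card_fin] at h
          exact (le_of_eq (by congr!)).trans h
      _ = (k : ℝ) ^ (D + 1) * r ^ (k - (D + 1)) * m ^ k := by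
          simp [mul_assoc]
  have hsplit := sum_filter_add_sum_filter_not (univ : Finset (Fin k → ι))
    (fun v => p ∈ convexHull ℝ (Set.range (x ∘ v))) fun v => ∏ j, u (v j)
  have hhalf := mul_le_mul_of_nonneg_right hk (pow_nonneg hm0 k)
  rw [htotal] at hsplit
  linarith

open Finset in
open Classical in
/-- One round of the greedy construction of a weak net: a convex set of weight at least `ε` that
avoids `S` yields a point meeting the convex hulls of many new `k`-tuples. -/
lemma exists_insert_of_forall_notMem (k : ℕ) (hk0 : 0 < k) (hk : 2 * ((k : ℝ) ^ (finrank ℝ E + 1) *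
      (finrank ℝ E / (finrank ℝ E + 1) : ℝ) ^ (k - (finrank ℝ E + 1))) ≤ 1)
    {ι : Type*} [Fintype ι] (x : ι → E) (w : ι → ℝ) (hw : ∀ i, 0 ≤ w i) {ε : ℝ} (hε : 0 ≤ ε)
    {K : Set E} (hK : Convex ℝ K) (hwK : ε ≤ ∑ i with x i ∈ K, w i) (S : Finset E)
    (hS : ∀ p ∈ S, p ∉ K) :
    ∃ p : E,
      2 * ∑ v : Fin k → ι with ∃ q ∈ S, q ∈ convexHull ℝ (Set.range (x ∘ v)), ∏ j, w (v j) +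
        ε ^ k ≤ 2 * ∑ v : Fin k → ι with ∃ q ∈ insert p S, q ∈ convexHull ℝ (Set.range (x ∘ v)),
          ∏ j, w (v j) := by
  obtain ⟨p, hp⟩ := exists_point_in_half_of_hulls k hk0 hk x (fun i => if x i ∈ K then w i else 0)
    fun i => by split_ifs; exacts [hw i, le_rfl]
  refine ⟨p, ?_⟩
  rw [← sum_filter] at hp
  have hprod : ∀ v : Fin k → ι, 0 ≤ ∏ j, w (v j) := fun v => prod_nonneg fun j _ => hw _
  suffices h : ∑ v : Fin k → ι with ∃ q ∈ S, q ∈ convexHull ℝ (Set.range (x ∘ v)), ∏ j, w (v j) +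
      ∑ v : Fin k → ι with p ∈ convexHull ℝ (Set.range (x ∘ v)),
        ∏ j, (if x (v j) ∈ K then w (v j) else 0) ≤
      ∑ v : Fin k → ι with ∃ q ∈ insert p S, q ∈ convexHull ℝ (Set.range (x ∘ v)),
        ∏ j, w (v j) by
    have := pow_le_pow_left₀ hε hwK k
    linarith
  rw [sum_filter, sum_filter, sum_filter, ← sum_add_distrib]
  refine sum_le_sum fun v _ => ?_
  simp only [exists_mem_insert]
  by_cases hv : ∀ j, x (v j) ∈ K
  · have hsub : convexHull ℝ (Set.range (x ∘ v)) ⊆ K :=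
      convexHull_min (Set.range_subset_iff.2 hv) hK
    have hnot : ¬ ∃ q ∈ S, q ∈ convexHull ℝ (Set.range (x ∘ v)) :=
      fun ⟨q, hq, hq'⟩ => hS q hq (hsub hq')
    simp [hnot, hv]
  · have hzero : ∏ j, (if x (v j) ∈ K then w (v j) else 0) = 0 := by
      push Not at hv
      obtain ⟨j, hj⟩ := hv
      exact prod_eq_zero (mem_univ j) (if_neg hj)
    rw [hzero, ite_self, add_zero]
    have := hprod v
    split_ifs with h1 h2
    · exact le_rfl
    · exact absurd (Or.inr h1) h2
    · exact this
    · exact le_rfl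

open Finset in
/-- Weak nets for weighted points indexed by a finite type. -/
lemma exists_weak_net (k : ℕ) (hk0 : 0 < k) (hk : 2 * ((k : ℝ) ^ (finrank ℝ E + 1) *
      (finrank ℝ E / (finrank ℝ E + 1) : ℝ) ^ (k - (finrank ℝ E + 1))) ≤ 1)
    {ι κ : Type*} [Fintype ι] (x : ι → E) (w : ι → ℝ) (hw : ∀ i, 0 ≤ w i) (hw1 : ∑ i, w i = 1)
    {ε : ℝ} (hε : 0 < ε) (C : κ → Set E) [∀ c, DecidablePred (· ∈ C c)]
    (hC : ∀ c, Convex ℝ (C c)) (hwC : ∀ c, ε ≤ ∑ i with x i ∈ C c, w i) :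
    ∃ S : Finset E, #S ≤ ⌊2 / ε ^ k⌋₊ + 1 ∧ ∀ c, ∃ p ∈ S, p ∈ C c := by
  classical
  by_contra! hno
  have hgreedy : ∀ n ≤ ⌊2 / ε ^ k⌋₊ + 1, ∃ S : Finset E, #S ≤ n ∧ n * ε ^ k ≤
      2 * ∑ v : Fin k → ι with ∃ q ∈ S, q ∈ convexHull ℝ (Set.range (x ∘ v)), ∏ j, w (v j) := by
    intro n
    induction n with
    | zero => exact fun _ => ⟨∅, by simp⟩
    | succ n ih =>
      intro hn
      obtain ⟨S, hS, hmass⟩ := ih (by omega)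
      obtain ⟨c, hc⟩ := hno S (by omega)
      obtain ⟨p, hp⟩ := exists_insert_of_forall_notMem k hk0 hk x w hw hε.le (hC c)
        (by convert hwC c) S hc
      refine ⟨insert p S, (card_insert_le _ _).trans (by omega), ?_⟩
      push_cast
      linarith
  obtain ⟨S, -, hmass⟩ := hgreedy _ le_rfl
  have hle : ∑ v : Fin k → ι with ∃ q ∈ S, q ∈ convexHull ℝ (Set.range (x ∘ v)),
      ∏ j, w (v j) ≤ 1 := by
    calc _ ≤ ∑ v : Fin k → ι, ∏ j, w (v j) :=
          sum_le_sum_of_subset_of_nonneg (filter_subset _ _)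
            fun v _ _ => prod_nonneg fun j _ => hw _
      _ = 1 := by
          have := prod_univ_sum (fun _ : Fin k => (univ : Finset ι)) fun _ i => w i
          rw [prod_const, Fintype.piFinset_univ, hw1, one_pow] at this
          exact this.symm
  have hlt := Nat.lt_floor_add_one (2 / ε ^ k)
  rw [div_lt_iff₀ (pow_pos hε k)] at hlt
  push_cast at hmass
  linarith

end

open Filter in
lemma exists_pow_mul_pow_sub_le {r : ℝ} (hr0 : 0 < r) (hr1 : r < 1) (c : ℕ) :
    ∃ k : ℕ, 0 < k ∧ 2 * ((k : ℝ) ^ c * r ^ (k - c)) ≤ 1 := by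
  have h := tendsto_pow_const_mul_const_pow_of_abs_lt_one c (abs_lt.2 ⟨by linarith, hr1⟩)
  have hc : 0 < r ^ c := pow_pos hr0 c
  obtain ⟨k, hk, hck⟩ :=
    ((h.eventually_lt_const (half_pos hc)).and (eventually_gt_atTop c)).exists
  refine ⟨k, by omega, ?_⟩
  have hsplit : r ^ k = r ^ (k - c) * r ^ c := by rw [← pow_add, Nat.sub_add_cancel hck.le]
  rw [hsplit] at hk
  by_contra! hlt
  nlinarith [mul_lt_mul_of_pos_right hlt hc]

/-- Weak Epsilon Net Theorem (Alon–Bárány–Füredi–Kleitman). -/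
theorem weak_epsilon_net (d : ℕ) (hd : 1 ≤ d) :
    ∃ f : ℝ → ℝ,
      ∀ ε : ℝ, ε ∈ Set.Ioc (0 : ℝ) 1 →
        ∀ n : ℕ, ∀ C : Fin n → Set (EuclideanSpace ℝ (Fin d)),
          (∀ i, Convex ℝ (C i) ∧ IsCompact (C i) ∧ (interior (C i)).Nonempty) →
          ∀ w : EuclideanSpace ℝ (Fin d) → ℝ,
            (Function.support w).Finite →
            (∀ x, w x ∈ Set.Icc (0 : ℝ) 1) →
            (∑ᶠ x, w x) = 1 →
            (∀ i, ε ≤ ∑ᶠ x ∈ C i, w x) →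
            ∃ S : Finset (EuclideanSpace ℝ (Fin d)),
              (S.card : ℝ) ≤ f ε ∧
              ∀ i, ∃ p ∈ S, p ∈ C i := by
  classical
  have hrank : Module.finrank ℝ (EuclideanSpace ℝ (Fin d)) = d := finrank_euclideanSpace_fin
  have hd' : (0 : ℝ) < d := by exact_mod_cast hd
  obtain ⟨k, hk0, hk⟩ := exists_pow_mul_pow_sub_le (r := (d : ℝ) / (d + 1)) (by positivity)
    (by rw [div_lt_one (by positivity)]; linarith) (d + 1)
  refine ⟨fun ε => ((⌊2 / ε ^ k⌋₊ + 1 : ℕ) : ℝ), fun ε hε n C hC w hfin hw hw1 hwC => ?_⟩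
  have hsum : ∑ x : hfin.toFinset, w x = 1 := by
    rw [Finset.sum_coe_sort hfin.toFinset w, ← hw1, finsum_eq_sum w hfin]
  have hsumC : ∀ i, ε ≤ ∑ x : hfin.toFinset with x.1 ∈ C i, w x := by
    intro i
    refine (hwC i).trans_eq ?_
    rw [finsum_mem_eq_sum_filter w _ hfin, Finset.sum_filter, Finset.sum_filter,
      Finset.sum_coe_sort hfin.toFinset fun x => if x ∈ C i then w x else 0]
  obtain ⟨S, hS, hSC⟩ := exists_weak_net k hk0 (by rwa [hrank])
    (fun x : hfin.toFinset => x.1) (fun x => w x)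
    (fun x => (hw x).1) hsum hε.1 C (fun i => (hC i).1) hsumC
  exact ⟨S, Nat.cast_le.2 hS, hSC⟩
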